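/- (Concavity of the Petz Augustin auxiliary function E_0^{(2)}(s,P) on (−1,0).) The map s ↦ s·I^{(2)}_{1/(1+s)}(P,W) is concave on the interval (−1,0); note that 1/(1+s) ∈ (1,∞) for s ∈ (−1,0). -/

import Mathlib

open Matrix
open scoped ComplexOrder

/-- Real power of a (hermitian) matrix via the continuous functional calculus. -/
noncomputable def mpow {ι : Type*} [Fintype ι] [DecidableEq ι]
    (A : Matrix ι ι ℂ) (r : ℝ) : Matrix ι ι ℂ :=
  cfc (fun x : ℝ => x ^ r) A

/-- Logarithm of a (hermitian) matrix via the continuous functional calculus. -/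
noncomputable def mlog {ι : Type*} [Fintype ι] [DecidableEq ι]
    (A : Matrix ι ι ℂ) : Matrix ι ι ℂ :=
  cfc Real.log A

/-- Real part of the trace. -/
noncomputable def trR {ι : Type*} [Fintype ι] (A : Matrix ι ι ℂ) : ℝ :=
  (Matrix.trace A).re

/-- Positive definite density matrices. -/
def Dens (d : ℕ) : Type :=
  {σ : Matrix (Fin d) (Fin d) ℂ // σ.PosDef ∧ σ.trace = 1}

/-- Petz Rényi divergence of order `α ≠ 1`. -/
noncomputable def Dpetz {d : ℕ} (α : ℝ) (ρ σ : Matrix (Fin d) (Fin d) ℂ) : ℝ :=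
  (1 / (α - 1)) * Real.log (trR (mpow ρ α * mpow σ (1 - α)))

/-- Petz Augustin information (order `α ≠ 1`). -/
noncomputable def augustinInfo {d n : ℕ} (α : ℝ) (W : Fin n → Matrix (Fin d) (Fin d) ℂ)
    (P : Fin n → ℝ) : ℝ :=
  ⨅ σ : Dens d, ∑ i, P i * Dpetz α (W i) σ.1

lemma convexOn_rpow_neg {r : ℝ} (hr : 0 ≤ r) :
    ConvexOn ℝ (Set.Ioi 0) fun x : ℝ => x ^ (-r) := by
  refine ⟨convex_Ioi 0, fun x hx y hy a b ha hb hab => ?_⟩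
  simp only [Set.mem_Ioi] at hx hy
  have hxr := Real.rpow_nonneg hx.le (-r)
  have hyr := Real.rpow_nonneg hy.le (-r)
  calc (a • x + b • y) ^ (-r) ≤ (x ^ a * y ^ b) ^ (-r) :=
        Real.rpow_le_rpow_of_nonpos (by positivity)
          (Real.geom_mean_le_arith_mean2_weighted ha hb hx.le hy.le hab) (by linarith)
    _ = (x ^ (-r)) ^ a * (y ^ (-r)) ^ b := by
        rw [Real.mul_rpow (by positivity) (by positivity), ← Real.rpow_mul hx.le,
          ← Real.rpow_mul hy.le, ← Real.rpow_mul hx.le, ← Real.rpow_mul hy.le, mul_comm a,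
          mul_comm b]
    _ ≤ a • x ^ (-r) + b • y ^ (-r) :=
        Real.geom_mean_le_arith_mean2_weighted ha hb hxr hyr hab

lemma sum_rpow_mul_rpow_le {ι : Type*} [Fintype ι] {s t : ι → ℝ} (hs : ∀ i, 0 ≤ s i)
    (ht : ∀ i, 0 ≤ t i) {a b : ℝ} (ha : 0 < a) (hb : 0 < b) :
    (∑ i, t i ^ (a / (a + b)) * s i ^ (b / (a + b))) ^ (a + b) ≤
      (∑ i, t i) ^ a * (∑ i, s i) ^ b := by
  have hab : 0 < a + b := add_pos ha hb
  have hpq : Real.HolderConjugate ((a + b) / a) ((a + b) / b) := by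
    refine Real.holderConjugate_iff.2 ⟨?_, ?_⟩
    · rw [one_lt_div ha]; linarith
    · field_simp
  have h := Real.inner_le_Lp_mul_Lq_of_nonneg Finset.univ hpq
    (f := fun i => t i ^ (a / (a + b))) (g := fun i => s i ^ (b / (a + b)))
    (fun i _ => Real.rpow_nonneg (ht i) _) (fun i _ => Real.rpow_nonneg (hs i) _)
  have e1 : ∀ i, (t i ^ (a / (a + b))) ^ ((a + b) / a) = t i := fun i => by
    rw [← Real.rpow_mul (ht i), div_mul_div_cancel₀ hab.ne', div_self ha.ne', Real.rpow_one]
  have e2 : ∀ i, (s i ^ (b / (a + b))) ^ ((a + b) / b) = s i := fun i => by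
    rw [← Real.rpow_mul (hs i), div_mul_div_cancel₀ hab.ne', div_self hb.ne', Real.rpow_one]
  simp only [e1, e2, one_div_div] at h
  have hS : 0 ≤ ∑ i, s i := Finset.sum_nonneg fun i _ => hs i
  have hT : 0 ≤ ∑ i, t i := Finset.sum_nonneg fun i _ => ht i
  refine (Real.rpow_le_rpow (Finset.sum_nonneg fun i _ =>
    mul_nonneg (Real.rpow_nonneg (ht i) _) (Real.rpow_nonneg (hs i) _)) h hab.le).trans_eq ?_
  rw [Real.mul_rpow (Real.rpow_nonneg hT _) (Real.rpow_nonneg hS _), ← Real.rpow_mul hT,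
    ← Real.rpow_mul hS, div_mul_cancel₀ _ hab.ne', div_mul_cancel₀ _ hab.ne']

section MatrixPowers

variable {ι : Type*} [Fintype ι] [DecidableEq ι] {A : Matrix ι ι ℂ}

lemma continuousOn_spectrum (A : Matrix ι ι ℂ) (f : ℝ → ℝ) : ContinuousOn f (spectrum ℝ A) :=
  (Matrix.finite_real_spectrum (A := A)).continuousOn f

lemma continuousOn_image_spectrum (A : Matrix ι ι ℂ) (f g : ℝ → ℝ) :
    ContinuousOn g (f '' spectrum ℝ A) :=
  ((Matrix.finite_real_spectrum (A := A)).image f).continuousOn g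

lemma spectrum_pos (hA : A.PosDef) {x : ℝ} (hx : x ∈ spectrum ℝ A) : 0 < x := by
  rw [hA.isHermitian.spectrum_real_eq_range_eigenvalues] at hx
  obtain ⟨i, rfl⟩ := hx
  exact hA.eigenvalues_pos i

lemma mpow_eq (hA : A.IsHermitian) (r : ℝ) :
    mpow A r = (hA.eigenvectorUnitary : Matrix ι ι ℂ) *
      diagonal (fun i => ((hA.eigenvalues i ^ r : ℝ) : ℂ)) *
      (hA.eigenvectorUnitary : Matrix ι ι ℂ)ᴴ := by
  rw [mpow, hA.cfc_eq, Matrix.IsHermitian.cfc, Unitary.conjStarAlgAut_apply]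
  rfl

lemma mpow_add (hA : A.PosDef) (r s : ℝ) : mpow A (r + s) = mpow A r * mpow A s := by
  rw [mpow, mpow, mpow, ← cfc_mul _ _ A (continuousOn_spectrum _ _) (continuousOn_spectrum _ _)]
  exact cfc_congr fun x hx => Real.rpow_add (spectrum_pos hA hx) r s

lemma mpow_one (hA : A.PosDef) : mpow A 1 = A := by
  have : IsSelfAdjoint A := hA.isHermitian
  simp only [mpow, Real.rpow_one]
  exact cfc_id' ℝ A

lemma mpow_zero (hA : A.PosDef) : mpow A 0 = 1 := by
  have : IsSelfAdjoint A := hA.isHermitian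
  simp only [mpow, Real.rpow_zero]
  exact cfc_const_one ℝ A

lemma mpow_mpow (hA : A.PosDef) (r s : ℝ) : mpow (mpow A r) s = mpow A (r * s) := by
  have : IsSelfAdjoint A := hA.isHermitian
  rw [mpow, mpow, mpow, ← cfc_comp' _ _ A (continuousOn_image_spectrum _ _ _)
    (continuousOn_spectrum _ _)]
  exact cfc_congr fun x hx => (Real.rpow_mul (spectrum_pos hA hx).le r s).symm

lemma mpow_smul (hA : A.PosDef) {c : ℝ} (hc : 0 ≤ c) (r : ℝ) :
    mpow (c • A) r = c ^ r • mpow A r := by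
  have : IsSelfAdjoint A := hA.isHermitian
  rw [mpow, mpow, ← cfc_comp_smul c _ A (continuousOn_image_spectrum _ _ _),
    ← cfc_smul _ _ A (continuousOn_spectrum _ _)]
  exact cfc_congr fun x hx => Real.mul_rpow hc (spectrum_pos hA hx).le

lemma mpow_posDef (hA : A.PosDef) (r : ℝ) : (mpow A r).PosDef := by
  rw [mpow_eq hA.isHermitian r]
  refine (Matrix.IsUnit.posDef_star_right_conjugate_iff
    (U := (hA.isHermitian.eigenvectorUnitary : Matrix ι ι ℂ)) ?_).2 ?_
  · exact Unitary.isUnit_coe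
  · refine Matrix.PosDef.diagonal fun i => ?_
    exact_mod_cast Real.rpow_pos_of_pos (hA.eigenvalues_pos i) r

lemma mpow_conjTranspose (hA : A.PosDef) (r : ℝ) : (mpow A r)ᴴ = mpow A r :=
  (mpow_posDef hA r).isHermitian

lemma mpow_half_mul_self (hA : A.PosDef) (r : ℝ) :
    mpow A (r / 2) * mpow A (r / 2) = mpow A r := by
  rw [← mpow_add hA, add_halves]

lemma mpow_mul_mpow_neg (hA : A.PosDef) (r : ℝ) : mpow A r * mpow A (-r) = 1 := by
  rw [← mpow_add hA, add_neg_cancel, mpow_zero hA]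

lemma mpow_neg_mul_mpow (hA : A.PosDef) (r : ℝ) : mpow A (-r) * mpow A r = 1 := by
  rw [← mpow_add hA, neg_add_cancel, mpow_zero hA]

lemma isUnit_mpow (hA : A.PosDef) (r : ℝ) : IsUnit (mpow A r) := (mpow_posDef hA r).isUnit

lemma mpow_neg_one (hA : A.PosDef) : mpow A (-1) = A⁻¹ := by
  refine (Matrix.inv_eq_left_inv ?_).symm
  nth_rw 2 [← mpow_one hA]
  exact mpow_neg_mul_mpow hA 1

/-- Diagonal entries of a power, in any orthonormal basis, are averages of powers of eigenvalues
with the same weights for all exponents. -/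
lemma exists_weights_diag_mpow (hA : A.PosDef) {U : Matrix ι ι ℂ} (hU : Uᴴ * U = 1) (k : ι) :
    ∃ w : ι → ℝ, (∀ j, 0 ≤ w j) ∧ ∑ j, w j = 1 ∧
      ∀ r, ((Uᴴ * mpow A r * U) k k).re = ∑ j, w j * hA.isHermitian.eigenvalues j ^ r := by
  set V : Matrix ι ι ℂ := (hA.isHermitian.eigenvectorUnitary : Matrix ι ι ℂ) with hV
  have key : ∀ r, ((Uᴴ * mpow A r * U) k k).re =
      ∑ j, Complex.normSq ((Uᴴ * V) k j) * hA.isHermitian.eigenvalues j ^ r := by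
    intro r
    have h1 : Uᴴ * mpow A r * U = (Uᴴ * V) *
        diagonal (fun i => ((hA.isHermitian.eigenvalues i ^ r : ℝ) : ℂ)) * (Uᴴ * V)ᴴ := by
      rw [mpow_eq hA.isHermitian r, conjTranspose_mul, conjTranspose_conjTranspose]
      simp only [Matrix.mul_assoc, ← hV]
    rw [h1, Matrix.mul_apply, Complex.re_sum]
    refine Finset.sum_congr rfl fun j _ => ?_
    rw [Matrix.mul_diagonal, Matrix.conjTranspose_apply, mul_right_comm, Complex.star_def,
      Complex.mul_conj, ← Complex.ofReal_mul, Complex.ofReal_re]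
  refine ⟨_, fun j => Complex.normSq_nonneg _, ?_, key⟩
  have h0 := key 0
  rw [mpow_zero hA, Matrix.mul_one, hU] at h0
  simpa using h0.symm

lemma diag_mpow_le_rpow (hA : A.PosDef) {U : Matrix ι ι ℂ} (hU : Uᴴ * U = 1) (k : ι) {r : ℝ}
    (hr0 : 0 ≤ r) (hr1 : r ≤ 1) :
    ((Uᴴ * mpow A r * U) k k).re ≤ ((Uᴴ * A * U) k k).re ^ r := by
  obtain ⟨w, hw, hw1, h⟩ := exists_weights_diag_mpow hA hU k
  have h1 := h 1
  rw [mpow_one hA] at h1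
  simp only [Real.rpow_one] at h1
  rw [h, h1]
  exact (Real.concaveOn_rpow hr0 hr1).le_map_sum (fun j _ => hw j) hw1
    (fun j _ => (hA.eigenvalues_pos j).le)

lemma rpow_neg_le_diag_mpow (hA : A.PosDef) {U : Matrix ι ι ℂ} (hU : Uᴴ * U = 1) (k : ι) {r : ℝ}
    (hr : 0 ≤ r) :
    ((Uᴴ * A * U) k k).re ^ (-r) ≤ ((Uᴴ * mpow A (-r) * U) k k).re := by
  obtain ⟨w, hw, hw1, h⟩ := exists_weights_diag_mpow hA hU k
  have h1 := h 1
  rw [mpow_one hA] at h1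
  simp only [Real.rpow_one] at h1
  rw [h, h1]
  exact (convexOn_rpow_neg hr).map_sum_le (fun j _ => hw j) hw1 (fun j _ => hA.eigenvalues_pos j)

lemma trR_eq_sum_diag {U : Matrix ι ι ℂ} (hU : Uᴴ * U = 1) (A : Matrix ι ι ℂ) :
    trR A = ∑ k, ((Uᴴ * A * U) k k).re := by
  rw [trR, ← Complex.re_sum]
  change _ = (trace (Uᴴ * A * U)).re
  rw [Matrix.trace_mul_comm, ← Matrix.mul_assoc, mul_eq_one_comm.1 hU, Matrix.one_mul]

omit [DecidableEq ι] in
lemma trR_pos [Nonempty ι] (hA : A.PosDef) : 0 < trR A :=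
  (Complex.pos_iff.1 hA.trace_pos).1

end MatrixPowers

section SchattenHolder

variable {ι : Type*} [Fintype ι] [DecidableEq ι]

lemma posDef_mul_mpow_mul_conjTranspose {X τ : Matrix ι ι ℂ} (hX : IsUnit X) (hτ : τ.PosDef)
    (r : ℝ) : (X * mpow τ r * Xᴴ).PosDef :=
  (Matrix.IsUnit.posDef_star_right_conjugate_iff hX).2 (mpow_posDef hτ r)

lemma posDef_mul_conjTranspose_of_isUnit {X : Matrix ι ι ℂ} (hX : IsUnit X) :
    (X * Xᴴ).PosDef := by
  simpa [star_eq_conjTranspose] using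
    (Matrix.IsUnit.posDef_star_right_conjugate_iff hX).2 (Matrix.PosDef.one (n := ι))

/-- Hölder's inequality for Schatten quasi-norms, when one of the exponents is at least `2`. -/
lemma trR_mpow_mul_mpow_mul_le_of_le_one {X τ : Matrix ι ι ℂ} (hX : IsUnit X) (hτ : τ.PosDef)
    {a b : ℝ} (ha : 0 < a) (hb : 0 < b) (hb1 : b ≤ 1) :
    trR (mpow (X * mpow τ b * Xᴴ) (1 / (a + b))) ^ (a + b) ≤
      trR (mpow (X * Xᴴ) (1 / a)) ^ a * trR τ ^ b := by
  have hab : 0 < a + b := add_pos ha hb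
  have hQ := posDef_mul_mpow_mul_conjTranspose hX hτ b
  have hR := posDef_mul_conjTranspose_of_isUnit hX
  set Q := X * mpow τ b * Xᴴ with hQdef
  set R := X * Xᴴ with hRdef
  set U : Matrix ι ι ℂ := (hQ.isHermitian.eigenvectorUnitary : Matrix ι ι ℂ) with hUdef
  set m := hQ.isHermitian.eigenvalues with hm
  have hmpos : ∀ k, 0 < m k := hQ.eigenvalues_pos
  have hU : Uᴴ * U = 1 := Unitary.coe_star_mul_self hQ.isHermitian.eigenvectorUnitary
  have hU' : U * Uᴴ = 1 := mul_eq_one_comm.1 hU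
  have hQU : ∀ r, mpow Q r = U * diagonal (fun i => ((m i ^ r : ℝ) : ℂ)) * Uᴴ :=
    mpow_eq hQ.isHermitian
  have hdiag : ∀ r, Uᴴ * mpow Q r * U = diagonal (fun i => ((m i ^ r : ℝ) : ℂ)) := fun r => by
    rw [hQU]
    calc Uᴴ * (U * diagonal (fun i => ((m i ^ r : ℝ) : ℂ)) * Uᴴ) * U
        = (Uᴴ * U) * diagonal (fun i => ((m i ^ r : ℝ) : ℂ)) * (Uᴴ * U) := by
          simp only [Matrix.mul_assoc]
      _ = _ := by rw [hU, Matrix.one_mul, Matrix.mul_one]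
  set D : Matrix ι ι ℂ := diagonal (fun i => ((m i ^ (-1 / 2 : ℝ) : ℝ) : ℂ)) with hD
  set E : Matrix ι ι ℂ := diagonal (fun i => ((m i ^ (1 / 2 : ℝ) : ℝ) : ℂ)) with hE
  have hDh : Dᴴ = D := by
    rw [hD, diagonal_conjTranspose]; congr 1; ext i; simp
  have hEh : Eᴴ = E := by
    rw [hE, diagonal_conjTranspose]; congr 1; ext i; simp
  have hUQU : Uᴴ * Q * U * D = E := by
    have h1 := hdiag 1
    rw [mpow_one hQ] at h1
    rw [h1, hD, hE, diagonal_mul_diagonal]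
    congr 1; ext i
    rw [← Complex.ofReal_mul, ← Real.rpow_add (hmpos i)]
    norm_num
  have hDE : D * E = 1 := by
    rw [hD, hE, diagonal_mul_diagonal, ← diagonal_one]
    congr 1; ext i
    rw [← Complex.ofReal_mul, ← Real.rpow_add (hmpos i)]
    norm_num
  set T := mpow τ (b / 2) with hT
  have hTh : Tᴴ = T := mpow_conjTranspose hτ _
  have hTT : T * T = mpow τ b := mpow_half_mul_self hτ b
  set V := T * Xᴴ * U * D with hV
  have hVV : Vᴴ * V = 1 := by
    calc Vᴴ * V = D * (Uᴴ * (X * (T * T) * Xᴴ) * U * D) := by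
          rw [hV]
          simp only [conjTranspose_mul, conjTranspose_conjTranspose, hTh, hDh, Matrix.mul_assoc]
      _ = 1 := by rw [hTT, ← hQdef, hUQU, hDE]
  have hXdet : IsUnit X.det := (Matrix.isUnit_iff_isUnit_det X).1 hX
  have hTV : T * V = X⁻¹ * U * E := by
    calc T * V = X⁻¹ * X * (T * T) * Xᴴ * U * D := by
          rw [Matrix.nonsing_inv_mul X hXdet, Matrix.one_mul, hV]
          simp only [Matrix.mul_assoc]
      _ = X⁻¹ * (U * Uᴴ) * (X * (T * T) * Xᴴ) * U * D := by
          rw [hU', Matrix.mul_one]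
          simp only [Matrix.mul_assoc]
      _ = X⁻¹ * U * (Uᴴ * Q * U * D) := by
          rw [hTT, ← hQdef]
          simp only [Matrix.mul_assoc]
      _ = X⁻¹ * U * E := by rw [hUQU]
  have hRinv : mpow R (-1) = X⁻¹ᴴ * X⁻¹ := by
    rw [mpow_neg_one hR, hRdef, Matrix.mul_inv_rev, conjTranspose_nonsing_inv]
  have hVτV : Vᴴ * mpow τ b * V = E * (Uᴴ * mpow R (-1) * U) * E := by
    calc Vᴴ * mpow τ b * V = (T * V)ᴴ * (T * V) := by
          rw [← hTT, conjTranspose_mul T, hTh]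
          simp only [Matrix.mul_assoc]
      _ = _ := by
          rw [hTV, hRinv]
          simp only [conjTranspose_mul, hEh, Matrix.mul_assoc]
  set s : ι → ℝ := fun k => ((Vᴴ * τ * V) k k).re with hs
  set t : ι → ℝ := fun k => ((Uᴴ * mpow R (1 / a) * U) k k).re with ht
  have hspos : ∀ k, 0 ≤ s k := fun k =>
    (Complex.nonneg_iff.1 ((hτ.posSemidef.conjTranspose_mul_mul_same V).diag_nonneg (i := k))).1
  have hUunit : IsUnit U := IsUnit.of_mul_eq_one Uᴴ hU'
  have htpos : ∀ k, 0 < t k := fun k => by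
    have h := (Matrix.IsUnit.posDef_star_left_conjugate_iff hUunit).2 (mpow_posDef hR (1 / a))
    exact (Complex.pos_iff.1 (h.diag_pos (i := k))).1
  have hle : ∀ k, m k ≤ t k ^ a * s k ^ b := fun k => by
    have h1 : ((Vᴴ * mpow τ b * V) k k).re ≤ s k ^ b := diag_mpow_le_rpow hτ hVV k hb.le hb1
    have h2 : t k ^ (-a) ≤ ((Uᴴ * mpow R (-1) * U) k k).re := by
      have := rpow_neg_le_diag_mpow (mpow_posDef hR (1 / a)) hU k ha.le
      rwa [mpow_mpow hR, show 1 / a * -a = -1 by field_simp] at this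
    have h3 : ((Vᴴ * mpow τ b * V) k k).re = m k * ((Uᴴ * mpow R (-1) * U) k k).re := by
      rw [hVτV, hE, Matrix.mul_diagonal, Matrix.diagonal_mul, mul_right_comm,
        ← Complex.ofReal_mul, ← Real.rpow_add (hmpos k), Complex.re_ofReal_mul]
      norm_num
    have h4 : m k * t k ^ (-a) ≤ s k ^ b :=
      (mul_le_mul_of_nonneg_left h2 (hmpos k).le).trans (h3 ▸ h1)
    calc m k = t k ^ a * (m k * t k ^ (-a)) := by
          rw [mul_left_comm, ← Real.rpow_add (htpos k), add_neg_cancel, Real.rpow_zero, mul_one]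
      _ ≤ _ := mul_le_mul_of_nonneg_left h4 (Real.rpow_nonneg (htpos k).le _)
  have htr : trR (mpow Q (1 / (a + b))) = ∑ k, m k ^ (1 / (a + b)) := by
    rw [trR_eq_sum_diag hU]
    exact Finset.sum_congr rfl fun k _ => by rw [hdiag, diagonal_apply_eq, Complex.ofReal_re]
  rw [htr, trR_eq_sum_diag hU (mpow R (1 / a)), trR_eq_sum_diag hVV τ]
  refine le_trans ?_ (sum_rpow_mul_rpow_le hspos (fun k => (htpos k).le) ha hb)
  refine Real.rpow_le_rpow (Finset.sum_nonneg fun k _ => Real.rpow_nonneg (hmpos k).le _)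
    (Finset.sum_le_sum fun k _ => ?_) hab.le
  calc m k ^ (1 / (a + b)) ≤ (t k ^ a * s k ^ b) ^ (1 / (a + b)) :=
        Real.rpow_le_rpow (hmpos k).le (hle k) (by positivity)
    _ = _ := by
        rw [Real.mul_rpow (Real.rpow_nonneg (htpos k).le _) (Real.rpow_nonneg (hspos k) _),
          ← Real.rpow_mul (htpos k).le, ← Real.rpow_mul (hspos k), mul_one_div, mul_one_div]

/-- Hölder's inequality for Schatten quasi-norms. -/
lemma trR_mpow_mul_mpow_mul_le {X τ : Matrix ι ι ℂ} (hX : IsUnit X) (hτ : τ.PosDef)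
    {a b : ℝ} (ha : 0 < a) (hb : 0 < b) :
    trR (mpow (X * mpow τ b * Xᴴ) (1 / (a + b))) ^ (a + b) ≤
      trR (mpow (X * Xᴴ) (1 / a)) ^ a * trR τ ^ b := by
  have hτ0 : 0 ≤ trR τ := (Complex.nonneg_iff.1 hτ.posSemidef.trace_nonneg).1
  have key : ∀ c : ℝ, 0 < c → c ≤ 1 → ∀ k : ℕ,
      trR (mpow (X * mpow τ (k * c) * Xᴴ) (1 / (a + k * c))) ^ (a + k * c) ≤
        trR (mpow (X * Xᴴ) (1 / a)) ^ a * trR τ ^ (k * c) := by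
    intro c hc hc1 k
    induction k with
    | zero => simp [mpow_zero hτ]
    | succ k ih =>
      have hY : IsUnit (X * mpow τ (k * c / 2)) := hX.mul (isUnit_mpow hτ _)
      have h := trR_mpow_mul_mpow_mul_le_of_le_one hY hτ
        (show 0 < a + k * c by positivity) hc hc1
      have e1 : X * mpow τ (k * c / 2) * mpow τ c * (X * mpow τ (k * c / 2))ᴴ =
          X * mpow τ ((k + 1 : ℕ) * c) * Xᴴ := by
        rw [conjTranspose_mul, mpow_conjTranspose hτ,
          show ((k + 1 : ℕ) * c : ℝ) = k * c / 2 + c + k * c / 2 by push_cast; ring,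
          mpow_add hτ, mpow_add hτ]
        simp only [Matrix.mul_assoc]
      have e2 : X * mpow τ (k * c / 2) * (X * mpow τ (k * c / 2))ᴴ =
          X * mpow τ (k * c) * Xᴴ := by
        rw [conjTranspose_mul, mpow_conjTranspose hτ, ← mpow_half_mul_self hτ (k * c)]
        simp only [Matrix.mul_assoc]
      have e3 : a + k * c + c = a + (k + 1 : ℕ) * c := by push_cast; ring
      rw [e1, e2, e3] at h
      refine h.trans ((mul_le_mul_of_nonneg_right ih (Real.rpow_nonneg hτ0 _)).trans_eq ?_)
      rw [mul_assoc, ← Real.rpow_add_of_nonneg hτ0 (by positivity) hc.le]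
      congr 3
      push_cast; ring
  obtain ⟨N, hN⟩ := exists_nat_gt b
  have hN0 : (0 : ℝ) < N := hb.trans hN
  have h := key (b / N) (by positivity) ((div_le_one hN0).2 hN.le) N
  rwa [mul_div_cancel₀ b hN0.ne'] at h

end SchattenHolder

section GeometricMean

variable {ι : Type*} [Fintype ι] [DecidableEq ι]

/-- Solvability of the Riccati equation `A S⁻¹ A = T`, by the geometric mean of `S` and `T`. -/
lemma exists_posDef_riccati {S T : Matrix ι ι ℂ} (hS : S.PosDef) (hT : T.PosDef) :
    ∃ A : Matrix ι ι ℂ, A.PosDef ∧ A * S⁻¹ * A = T := by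
  set H := mpow S (1 / 2) with hH
  set K := mpow S (-(1 / 2)) with hK
  have hHK : H * K = 1 := mpow_mul_mpow_neg hS _
  have hKH : K * H = 1 := mpow_neg_mul_mpow hS _
  have hKK : S⁻¹ = K * K := by
    rw [← mpow_neg_one hS, hK, ← mpow_add hS]
    norm_num
  have hD : (K * T * K).PosDef := by
    have := (Matrix.IsUnit.posDef_star_right_conjugate_iff (isUnit_mpow hS (-(1 / 2)))).2 hT
    rwa [star_eq_conjTranspose, mpow_conjTranspose hS] at this
  set G := mpow (K * T * K) (1 / 2) with hG
  have hGG : G * G = K * T * K := by rw [hG, mpow_half_mul_self hD, mpow_one hD]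
  refine ⟨H * G * H, ?_, ?_⟩
  · have := (Matrix.IsUnit.posDef_star_right_conjugate_iff (isUnit_mpow hS (1 / 2))).2
      (mpow_posDef hD (1 / 2))
    rwa [star_eq_conjTranspose, mpow_conjTranspose hS] at this
  · calc H * G * H * S⁻¹ * (H * G * H) = H * G * (H * K) * (K * H) * G * H := by
          rw [hKK]; simp only [Matrix.mul_assoc]
      _ = H * (G * G) * H := by
          rw [hHK, hKH]; simp only [Matrix.mul_assoc, Matrix.one_mul]
      _ = (H * K) * T * (K * H) := by rw [hGG]; simp only [Matrix.mul_assoc]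
      _ = T := by rw [hHK, hKH, Matrix.one_mul, Matrix.mul_one]

omit [DecidableEq ι] in
/-- Cauchy–Schwarz for the Hilbert–Schmidt inner product. -/
lemma sq_trR_conjTranspose_mul_le (P Q : Matrix ι ι ℂ) :
    trR (Pᴴ * Q) ^ 2 ≤ trR (Pᴴ * P) * trR (Qᴴ * Q) := by
  have h : ∀ M N : Matrix ι ι ℂ, trR (Mᴴ * N) =
      ∑ x : (ι × ι) × Bool, (cond x.2 (M x.1.1 x.1.2).re (M x.1.1 x.1.2).im) *
        (cond x.2 (N x.1.1 x.1.2).re (N x.1.1 x.1.2).im) := by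
    intro M N
    simp only [trR, Matrix.trace, Matrix.diag, Matrix.mul_apply, Complex.re_sum,
      Fintype.sum_prod_type, Fintype.sum_bool, Matrix.conjTranspose_apply]
    rw [Finset.sum_comm]
    simp
  rw [h, h, h]
  simp only [← pow_two]
  exact Finset.sum_mul_sq_le_sq_mul_sq _ _ _

lemma sq_trR_mpow_mul_le {W A S T : Matrix ι ι ℂ} (hW : W.PosDef) (hA : A.PosDef)
    (hS : S.PosDef) (h : A * S⁻¹ * A = T) (α β : ℝ) :
    trR (mpow W ((α + β) / 2) * A) ^ 2 ≤ trR (mpow W α * S) * trR (mpow W β * T) := by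
  set H := mpow S (1 / 2) with hH
  set K := mpow S (-(1 / 2)) with hK
  have hHh : Hᴴ = H := mpow_conjTranspose hS _
  have hKh : Kᴴ = K := mpow_conjTranspose hS _
  have hHK : H * K = 1 := mpow_mul_mpow_neg hS _
  have hHH : H * H = S := by rw [hH, mpow_half_mul_self hS, mpow_one hS]
  have hKK : S⁻¹ = K * K := by
    rw [← mpow_neg_one hS, hK, ← mpow_add hS]
    norm_num
  have hAh : Aᴴ = A := hA.isHermitian
  have hWh : ∀ r, (mpow W r)ᴴ = mpow W r := mpow_conjTranspose hW
  have hcs := sq_trR_conjTranspose_mul_le (H * mpow W (α / 2)) (K * A * mpow W (β / 2))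
  have cyc : ∀ (r s : ℝ) (M : Matrix ι ι ℂ),
      trR (mpow W r * M * mpow W s) = trR (mpow W (s + r) * M) := fun r s M => by
    rw [trR, trR, Matrix.trace_mul_comm, ← Matrix.mul_assoc, ← mpow_add hW]
  have e1 : (H * mpow W (α / 2))ᴴ * (K * A * mpow W (β / 2)) =
      mpow W (α / 2) * A * mpow W (β / 2) := by
    calc _ = mpow W (α / 2) * (H * K) * A * mpow W (β / 2) := by
          simp only [conjTranspose_mul, hHh, hWh, Matrix.mul_assoc]
      _ = _ := by rw [hHK, Matrix.mul_one]
  have e2 : (H * mpow W (α / 2))ᴴ * (H * mpow W (α / 2)) =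
      mpow W (α / 2) * S * mpow W (α / 2) := by
    rw [← hHH]
    simp only [conjTranspose_mul, hHh, hWh, Matrix.mul_assoc]
  have e3 : (K * A * mpow W (β / 2))ᴴ * (K * A * mpow W (β / 2)) =
      mpow W (β / 2) * T * mpow W (β / 2) := by
    rw [← h, hKK]
    simp only [conjTranspose_mul, hKh, hAh, hWh, Matrix.mul_assoc]
  rw [e1, e2, e3, cyc, cyc, cyc, add_halves, add_halves] at hcs
  rwa [show (α + β) / 2 = β / 2 + α / 2 by ring]

lemma trR_mpow_neg_le_one_of_riccati {A σ τ : Matrix ι ι ℂ} (hA : A.PosDef) (hσ : σ.PosDef)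
    (hτ : τ.PosDef) (hσ1 : trR σ = 1) (hτ1 : trR τ = 1) {p q : ℝ} (hp : 0 < p) (hq : 0 < q)
    (h : A * (mpow σ (-p))⁻¹ * A = mpow τ (-q)) :
    trR (mpow A (-(2 / (p + q)))) ≤ 1 := by
  have hpq : 0 < p + q := add_pos hp hq
  have hAdet := (Matrix.isUnit_iff_isUnit_det A).1 hA.isUnit
  have hinv : ∀ {ρ : Matrix ι ι ℂ}, ρ.PosDef → ∀ r, (mpow ρ (-r))⁻¹ = mpow ρ r := fun hρ r =>
    Matrix.inv_eq_left_inv (mpow_mul_mpow_neg hρ r)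
  rw [hinv hσ] at h
  have hAinvh : A⁻¹ᴴ = A⁻¹ := hA.inv.isHermitian
  set X := A⁻¹ * mpow τ (-(q / 2)) with hX
  have hXu : IsUnit X := hA.inv.isUnit.mul (isUnit_mpow hτ _)
  have hXX : X * Xᴴ = mpow σ p := by
    calc X * Xᴴ = A⁻¹ * (mpow τ (-(q / 2)) * mpow τ (-(q / 2))) * A⁻¹ := by
          rw [hX, conjTranspose_mul, hAinvh, mpow_conjTranspose hτ]
          simp only [Matrix.mul_assoc]
      _ = (A⁻¹ * A) * mpow σ p * (A * A⁻¹) := by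
          rw [← mpow_add hτ, show -(q / 2) + -(q / 2) = -q by ring, ← h]
          simp only [Matrix.mul_assoc]
      _ = _ := by
          rw [Matrix.nonsing_inv_mul A hAdet, Matrix.mul_nonsing_inv A hAdet, Matrix.one_mul,
            Matrix.mul_one]
  have hXτX : X * mpow τ q * Xᴴ = mpow A (-2) := by
    calc X * mpow τ q * Xᴴ
        = A⁻¹ * (mpow τ (-(q / 2)) * mpow τ q * mpow τ (-(q / 2))) * A⁻¹ := by
          rw [hX, conjTranspose_mul, hAinvh, mpow_conjTranspose hτ]
          simp only [Matrix.mul_assoc]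
      _ = A⁻¹ * A⁻¹ := by
          rw [← mpow_add hτ, ← mpow_add hτ, show -(q / 2) + q + -(q / 2) = 0 by ring,
            mpow_zero hτ, Matrix.mul_one]
      _ = mpow A (-2) := by
          rw [← mpow_neg_one hA, ← mpow_add hA]; norm_num
  have hmain := trR_mpow_mul_mpow_mul_le hXu hτ hp hq
  rw [hXX, hXτX, mpow_mpow hA, mpow_mpow hσ, mul_one_div_cancel hp.ne', mpow_one hσ, hσ1, hτ1,
    Real.one_rpow, Real.one_rpow, one_mul, show -2 * (1 / (p + q)) = -(2 / (p + q)) by ring]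
    at hmain
  by_contra! hlt
  exact absurd hmain (not_le.2 (Real.one_lt_rpow hlt hpq))

end GeometricMean

lemma ConvexOn.of_midpoint_of_upperSemicontinuousOn {s : Set ℝ} {f : ℝ → ℝ} (hs : Convex ℝ s)
    (hf : UpperSemicontinuousOn f s)
    (hmid : ∀ x ∈ s, ∀ y ∈ s, f ((x + y) / 2) ≤ (f x + f y) / 2) : ConvexOn ℝ s f := by
  refine ⟨hs, fun x hx y hy a b ha hb hab => ?_⟩
  set ℓ : ℝ → ℝ := fun θ => x + θ * (y - x) with hℓ
  set φ : ℝ → ℝ := fun θ => f (ℓ θ) + -((1 - θ) * f x + θ * f y) with hφ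
  have hmaps : Set.MapsTo ℓ (Set.Icc 0 1) s := fun θ hθ => by
    have := hs hx hy (sub_nonneg.2 hθ.2) hθ.1 (sub_add_cancel 1 θ)
    convert this using 1
    simp only [hℓ, smul_eq_mul]; ring
  have hφmid : ∀ u ∈ Set.Icc (0 : ℝ) 1, ∀ v ∈ Set.Icc (0 : ℝ) 1,
      φ ((u + v) / 2) ≤ (φ u + φ v) / 2 := fun u hu v hv => by
    have h := hmid _ (hmaps hu) _ (hmaps hv)
    have e : ℓ ((u + v) / 2) = (ℓ u + ℓ v) / 2 := by simp only [hℓ]; ring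
    simp only [hφ, e]
    linarith
  have husc : UpperSemicontinuousOn φ (Set.Icc 0 1) := by
    refine UpperSemicontinuousOn.add (hf.comp (Continuous.continuousOn (by fun_prop)) hmaps) ?_
    exact ContinuousOn.upperSemicontinuousOn (Continuous.continuousOn (by fun_prop))
  obtain ⟨c, hc, hmax⟩ := husc.exists_isMaxOn (Set.nonempty_Icc.2 zero_le_one) isCompact_Icc
  have hφ0 : φ 0 = 0 := by simp [hφ, hℓ]
  have hφ1 : φ 1 = 0 := by simp [hφ, hℓ]
  have hφc : φ c ≤ 0 := by
    rcases le_total c (1 / 2) with h | h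
    · have hm : (2 * c) ∈ Set.Icc (0 : ℝ) 1 := ⟨by linarith [hc.1], by linarith⟩
      have h1 := hφmid 0 ⟨le_rfl, zero_le_one⟩ _ hm
      have h2 : φ (2 * c) ≤ φ c := hmax hm
      rw [show (0 + 2 * c) / 2 = c by ring] at h1
      linarith
    · have hm : (2 * c - 1) ∈ Set.Icc (0 : ℝ) 1 := ⟨by linarith, by linarith [hc.2]⟩
      have h1 := hφmid 1 ⟨zero_le_one, le_rfl⟩ _ hm
      have h2 : φ (2 * c - 1) ≤ φ c := hmax hm
      rw [show (1 + (2 * c - 1)) / 2 = c by ring] at h1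
      linarith
  have hb1 : b ≤ 1 := by linarith
  have h : φ b ≤ φ c := hmax ⟨hb, hb1⟩
  have ea : a = 1 - b := by linarith
  subst ea
  have e : (1 - b) • x + b • y = ℓ b := by simp only [hℓ, smul_eq_mul]; ring
  rw [e]
  simp only [hφ, smul_eq_mul] at h hφc ⊢
  linarith

section Augustin

variable {ι : Type*} [Fintype ι] [DecidableEq ι]

lemma trR_mul_pos [Nonempty ι] {A B : Matrix ι ι ℂ} (hA : A.PosDef) (hB : B.PosDef) :
    0 < trR (A * B) := by
  have h := trR_pos ((Matrix.IsUnit.posDef_star_right_conjugate_iff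
    (isUnit_mpow hA (1 / 2))).2 hB)
  rwa [star_eq_conjTranspose, mpow_conjTranspose hA, trR, Matrix.trace_mul_comm,
    ← Matrix.mul_assoc, mpow_half_mul_self hA, mpow_one hA] at h

omit [DecidableEq ι] in
lemma trR_smul (c : ℝ) (A : Matrix ι ι ℂ) : trR (c • A) = c * trR A := by
  simp [trR, Matrix.trace_smul]

lemma continuous_mpow {A : Matrix ι ι ℂ} (hA : A.PosDef) : Continuous fun r : ℝ => mpow A r := by
  simp only [mpow_eq hA.isHermitian]
  refine Continuous.matrix_mul (Continuous.matrix_mul continuous_const ?_) continuous_const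
  refine Continuous.matrix_diagonal (continuous_pi fun i => ?_)
  exact Complex.continuous_ofReal.comp (Real.continuous_const_rpow (hA.eigenvalues_pos i).ne')

lemma continuous_trR_mpow_mul_mpow {A B : Matrix ι ι ℂ} (hA : A.PosDef) (hB : B.PosDef) :
    Continuous fun α : ℝ => trR (mpow A α * mpow B (1 - α)) :=
  Complex.continuous_re.comp (Continuous.matrix_trace ((continuous_mpow hA).matrix_mul
    ((continuous_mpow hB).comp (continuous_const.sub continuous_id))))

lemma trR_mpow_le_trR_mpow_mul_mpow_neg {W σ : Matrix ι ι ℂ} (hW : W.PosDef) (hσ : σ.PosDef)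
    (hσ1 : trR σ = 1) (α : ℝ) {p : ℝ} (hp : 0 ≤ p) :
    trR (mpow W α) ≤ trR (mpow W α * mpow σ (-p)) := by
  set V : Matrix ι ι ℂ := (hW.isHermitian.eigenvectorUnitary : Matrix ι ι ℂ) with hV
  have hVV : Vᴴ * V = 1 := Unitary.coe_star_mul_self hW.isHermitian.eigenvectorUnitary
  have hVV' : V * Vᴴ = 1 := mul_eq_one_comm.1 hVV
  have hVunit : IsUnit V := IsUnit.of_mul_eq_one Vᴴ hVV'
  have key : ∀ S : Matrix ι ι ℂ, trR (mpow W α * S) =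
      ∑ k, hW.isHermitian.eigenvalues k ^ α * ((Vᴴ * S * V) k k).re := fun S => by
    rw [trR_eq_sum_diag hVV, mpow_eq hW.isHermitian]
    refine Finset.sum_congr rfl fun k _ => ?_
    rw [← hV]
    have e : ∀ D : Matrix ι ι ℂ, Vᴴ * (V * D * Vᴴ * S) * V = D * (Vᴴ * S * V) := fun D => by
      simp only [← Matrix.mul_assoc, hVV, Matrix.one_mul]
    rw [e, Matrix.diagonal_mul, Complex.re_ofReal_mul]
  have h1 := key 1
  rw [Matrix.mul_one] at h1
  rw [h1, key]
  refine Finset.sum_le_sum fun k _ => mul_le_mul_of_nonneg_left ?_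
    (Real.rpow_nonneg (hW.eigenvalues_pos k).le _)
  rw [Matrix.mul_one, hVV, Matrix.one_apply_eq, Complex.one_re]
  have hpos : ∀ j, 0 < ((Vᴴ * σ * V) j j).re := fun j =>
    (Complex.pos_iff.1 ((Matrix.IsUnit.posDef_star_left_conjugate_iff hVunit).2 hσ).diag_pos).1
  have hle : ((Vᴴ * σ * V) k k).re ≤ 1 := by
    rw [← hσ1, trR_eq_sum_diag hVV σ]
    exact Finset.single_le_sum (f := fun j => ((Vᴴ * σ * V) j j).re) (fun j _ => (hpos j).le)
      (Finset.mem_univ k)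
  exact (Real.one_le_rpow_of_pos_of_le_one_of_nonpos (hpos k) hle (by linarith)).trans
    (rpow_neg_le_diag_mpow hσ hVV k hp)

variable {d n : ℕ}

lemma Dens.trR_eq_one (σ : Dens d) : trR σ.1 = 1 := by
  rw [trR, σ.2.2, Complex.one_re]

lemma Dens.exists_midpoint [Nonempty (Fin d)] (σ τ : Dens d) {α β : ℝ} (hα : 1 < α)
    (hβ : 1 < β) :
    ∃ ω : Dens d, ∀ W : Matrix (Fin d) (Fin d) ℂ, W.PosDef →
      trR (mpow W ((α + β) / 2) * mpow ω.1 (1 - (α + β) / 2)) ^ 2 ≤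
        trR (mpow W α * mpow σ.1 (1 - α)) * trR (mpow W β * mpow τ.1 (1 - β)) := by
  set p := α - 1 with hp
  set q := β - 1 with hq
  have hp0 : 0 < p := sub_pos.2 hα
  have hq0 : 0 < q := sub_pos.2 hβ
  have hσ := mpow_posDef σ.2.1 (-p)
  have hτ := mpow_posDef τ.2.1 (-q)
  obtain ⟨A, hA, hAeq⟩ := exists_posDef_riccati hσ hτ
  have hc1 := trR_mpow_neg_le_one_of_riccati hA σ.2.1 τ.2.1 σ.trR_eq_one τ.trR_eq_one hp0 hq0 hAeq
  set S := mpow A (-(2 / (p + q))) with hSdef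
  have hS : S.PosDef := mpow_posDef hA _
  have hc0 : 0 < trR S := trR_pos hS
  have htr : S.trace = (trR S : ℂ) := by
    apply Complex.ext
    · simp [trR]
    · rw [Complex.ofReal_im]
      exact (Complex.pos_iff.1 hS.trace_pos).2.symm
  have hω : ((trR S)⁻¹ • S).PosDef := hS.smul (inv_pos.2 hc0)
  refine ⟨⟨(trR S)⁻¹ • S, hω, ?_⟩, fun W hW => ?_⟩
  · rw [Matrix.trace_smul, htr, Complex.real_smul, ← Complex.ofReal_mul,
      inv_mul_cancel₀ hc0.ne', Complex.ofReal_one]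
  · have hr : 1 - (α + β) / 2 = -((p + q) / 2) := by rw [hp, hq]; ring
    have hpow : mpow ((trR S)⁻¹ • S) (1 - (α + β) / 2) = trR S ^ ((p + q) / 2) • A := by
      rw [hr, mpow_smul hS (inv_nonneg.2 hc0.le), hSdef, mpow_mpow hA,
        show -(2 / (p + q)) * -((p + q) / 2) = 1 by field_simp, mpow_one hA, ← hSdef,
        Real.inv_rpow hc0.le, Real.rpow_neg hc0.le, inv_inv]
    have hcs := sq_trR_mpow_mul_le hW hA hσ hAeq α β
    rw [hp, hq, neg_sub, neg_sub] at hcs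
    refine le_trans ?_ hcs
    rw [hpow, Matrix.mul_smul, trR_smul]
    have hpos := trR_mul_pos (mpow_posDef hW ((α + β) / 2)) hA
    exact pow_le_pow_left₀ (mul_nonneg (Real.rpow_nonneg hc0.le _) hpos.le)
      (mul_le_of_le_one_left hpos.le (Real.rpow_le_one hc0.le hc1 (by positivity))) 2

lemma convexOn_iInf_sum_log_trR [Nonempty (Fin d)] {W : Fin n → Matrix (Fin d) (Fin d) ℂ}
    (hW : ∀ i, (W i).PosDef) {P : Fin n → ℝ} (hP : ∀ i, 0 ≤ P i) [Nonempty (Dens d)] :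
    ConvexOn ℝ (Set.Ioi 1) fun α : ℝ =>
      ⨅ σ : Dens d, ∑ i, P i * Real.log (trR (mpow (W i) α * mpow σ.1 (1 - α))) := by
  have hpos : ∀ (σ : Dens d) i α, 0 < trR (mpow (W i) α * mpow σ.1 (1 - α)) := fun σ i α =>
    trR_mul_pos (mpow_posDef (hW i) _) (mpow_posDef σ.2.1 _)
  have hbdd : ∀ α ∈ Set.Ioi (1 : ℝ), BddBelow (Set.range fun σ : Dens d =>
      ∑ i, P i * Real.log (trR (mpow (W i) α * mpow σ.1 (1 - α)))) := fun α hα => by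
    refine ⟨∑ i, P i * Real.log (trR (mpow (W i) α)), ?_⟩
    rintro _ ⟨σ, rfl⟩
    refine Finset.sum_le_sum fun i _ => mul_le_mul_of_nonneg_left ?_ (hP i)
    refine Real.log_le_log (trR_pos (mpow_posDef (hW i) α)) ?_
    have := trR_mpow_le_trR_mpow_mul_mpow_neg (hW i) σ.2.1 σ.trR_eq_one α
      (sub_nonneg.2 (Set.mem_Ioi.1 hα).le)
    rwa [neg_sub] at this
  refine ConvexOn.of_midpoint_of_upperSemicontinuousOn (convex_Ioi 1)
    (upperSemicontinuousOn_ciInf hbdd fun σ => ?_) fun α hα β hβ => ?_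
  · refine (Continuous.continuousOn ?_).upperSemicontinuousOn
    exact continuous_finsetSum _ fun i _ => continuous_const.mul
      ((continuous_trR_mpow_mul_mpow (hW i) σ.2.1).log fun α => (hpos σ i α).ne')
  · have hmem : (α + β) / 2 ∈ Set.Ioi (1 : ℝ) := by
      simp only [Set.mem_Ioi] at hα hβ ⊢; linarith
    rw [le_div_iff₀ two_pos, mul_comm]
    refine le_ciInf_add_ciInf fun σ τ => ?_
    obtain ⟨ω, hω⟩ := Dens.exists_midpoint σ τ hα hβ
    refine (mul_le_mul_of_nonneg_left (ciInf_le (hbdd _ hmem) ω) zero_le_two).trans ?_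
    rw [Finset.mul_sum, ← Finset.sum_add_distrib]
    refine Finset.sum_le_sum fun i _ => ?_
    have h := Real.log_le_log (pow_pos (hpos ω i _) 2) (hω (W i) (hW i))
    rw [Real.log_pow, Real.log_mul (hpos σ i α).ne' (hpos τ i β).ne', Nat.cast_ofNat] at h
    rw [mul_left_comm, ← mul_add]
    exact mul_le_mul_of_nonneg_left h (hP i)

lemma mul_augustinInfo_eq (W : Fin n → Matrix (Fin d) (Fin d) ℂ) (P : Fin n → ℝ) {s : ℝ}
    (hs : s ∈ Set.Ioo (-1 : ℝ) 0) :
    s * augustinInfo (1 / (1 + s)) W P = -((1 + s) * ⨅ σ : Dens d, ∑ i, P i *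
      Real.log (trR (mpow (W i) (1 / (1 + s)) * mpow σ.1 (1 - 1 / (1 + s))))) := by
  have h1 : 0 < 1 + s := by linarith [hs.1]
  have h2 : s ≠ 0 := hs.2.ne
  have hc : 1 / (1 / (1 + s) - 1) = -((1 + s) / s) := by
    rw [show 1 / (1 + s) - 1 = -(s / (1 + s)) by field_simp; ring, one_div, inv_neg, inv_div]
  have hc0 : 0 ≤ 1 / (1 / (1 + s) - 1) := by
    rw [hc, ← div_neg]
    exact div_nonneg h1.le (by linarith [hs.2])
  have hL : augustinInfo (1 / (1 + s)) W P = 1 / (1 / (1 + s) - 1) * ⨅ σ : Dens d, ∑ i, P i *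
      Real.log (trR (mpow (W i) (1 / (1 + s)) * mpow σ.1 (1 - 1 / (1 + s)))) := by
    rw [Real.mul_iInf_of_nonneg hc0, augustinInfo]
    refine iInf_congr fun σ => ?_
    rw [Finset.mul_sum]
    exact Finset.sum_congr rfl fun i _ => by rw [Dpetz]; ring
  rw [hL, hc, ← mul_assoc, mul_neg, mul_div_cancel₀ _ h2, neg_mul]

end Augustin

/-- concavity of the Petz Augustin auxiliary function
`E₀^{(2)}(s,P) = s·I^{(2)}_{1/(1+s)}(P,W)` on `(-1,0)`. -/
theorem petz_augustin_auxiliary_concave {d n : ℕ} (hd : 0 < d) (hn : 0 < n)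
    (W : Fin n → Matrix (Fin d) (Fin d) ℂ)
    (hW : ∀ i, (W i).PosDef ∧ (W i).trace = 1)
    (P : Fin n → ℝ) (hP : ∀ i, 0 ≤ P i) (hP1 : ∑ i, P i = 1) :
    ConcaveOn ℝ (Set.Ioo (-1 : ℝ) 0)
      (fun s => s * augustinInfo (1 / (1 + s)) W P) := by
  have : Nonempty (Fin d) := ⟨⟨0, hd⟩⟩
  have : Nonempty (Dens d) := ⟨⟨W ⟨0, hn⟩, hW _⟩⟩
  have hg := convexOn_iInf_sum_log_trR (fun i => (hW i).1) hP
  refine ⟨convex_Ioo _ _, fun x hx y hy a b ha hb hab => ?_⟩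
  have hz := convex_Ioo (-1 : ℝ) 0 hx hy ha hb hab
  simp only [mul_augustinInfo_eq W P hx, mul_augustinInfo_eq W P hy, mul_augustinInfo_eq W P hz]
  have hmem : ∀ {s : ℝ}, s ∈ Set.Ioo (-1 : ℝ) 0 → 0 < 1 + s ∧ 1 / (1 + s) ∈ Set.Ioi (1 : ℝ) :=
    fun {s} hs => by
      have h0 : 0 < 1 + s := by linarith [hs.1]
      exact ⟨h0, (one_lt_div h0).2 (by linarith [hs.2])⟩
  obtain ⟨hx0, hx1⟩ := hmem hx
  obtain ⟨hy0, hy1⟩ := hmem hy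
  obtain ⟨hz0, -⟩ := hmem hz
  simp only [smul_eq_mul] at hz0 ⊢
  have hsum : a * (1 + x) + b * (1 + y) = 1 + (a * x + b * y) := by linear_combination hab
  have h := hg.2 hx1 hy1
    (show 0 ≤ a * (1 + x) / (1 + (a * x + b * y)) from
      div_nonneg (mul_nonneg ha hx0.le) hz0.le)
    (show 0 ≤ b * (1 + y) / (1 + (a * x + b * y)) from
      div_nonneg (mul_nonneg hb hy0.le) hz0.le)
    (by rw [← add_div, hsum, div_self hz0.ne'])
  have e : a * (1 + x) / (1 + (a * x + b * y)) * (1 / (1 + x)) +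
      b * (1 + y) / (1 + (a * x + b * y)) * (1 / (1 + y)) = 1 / (1 + (a * x + b * y)) := by
    field_simp
    exact hab
  simp only [smul_eq_mul] at h
  rw [e] at h
  have h' := mul_le_mul_of_nonneg_left h hz0.le
  rw [mul_add, ← mul_assoc, ← mul_assoc, mul_div_cancel₀ _ hz0.ne', mul_div_cancel₀ _ hz0.ne']
    at h'
  linarith
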